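/- Catalan's identity for even index: let r be a nonnegative even integer and n an even natural number with n ≥ r. Then Q̃_{n−r}·Q̃_{n+r} − Q̃_n² = [α*·β*·((ab)^r − β^{2r}) + β*·α*·((ab)^r − α^{2r})]/((ab)^r·(α − β)²) + ε·[(α**·β*·α + α*·β**·β)·((ab)^r − β^{2r}) + (β*·α**·α + β**·α*·β)·((ab)^r − α^{2r})]/((ab)^r·(α − β)²). -/

import Mathlib

open Quaternion TrivSqZeroExt

/-- The bi-periodic Fibonacci sequence: `F 0 = 0`, `F 1 = 1`, and
`F n = a * F (n-1) + F (n-2)` if `n` is even, `F n = b * F (n-1) + F (n-2)` if `n` is odd. -/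
noncomputable def biF (a b : ℝ) : ℕ → ℝ
  | 0 => 0
  | 1 => 1
  | n + 2 => (if Even (n + 2) then a else b) * biF a b (n + 1) + biF a b n

/-- The bi-periodic Fibonacci quaternion `Q n = F n + F (n+1) i + F (n+2) j + F (n+3) k`. -/
noncomputable def biQ (a b : ℝ) (n : ℕ) : ℍ[ℝ] :=
  ⟨biF a b n, biF a b (n + 1), biF a b (n + 2), biF a b (n + 3)⟩

/-- The bi-periodic dual Fibonacci quaternion `Q̃ n = Q n + ε * Q (n+1)`,
an element of the dual numbers over the quaternions. -/
noncomputable def biDQ (a b : ℝ) (n : ℕ) : DualNumber ℍ[ℝ] :=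
  inl (biQ a b n) + DualNumber.eps * inl (biQ a b (n + 1))

theorem biF_binet (a b α β : ℝ) (hab : a * b ≠ 0) (hne : α - β ≠ 0)
    (hα : α ^ 2 = a * b * α + a * b) (hβ : β ^ 2 = a * b * β + a * b) (m : ℕ) :
    biF a b (2 * m) = a * ((α ^ 2 / (a * b)) ^ m - (β ^ 2 / (a * b)) ^ m) / (α - β) ∧
      biF a b (2 * m + 1) =
        (α * (α ^ 2 / (a * b)) ^ m - β * (β ^ 2 / (a * b)) ^ m) / (α - β) := by
  have hX : α ^ 2 / (a * b) = α + 1 := by rw [hα, ← mul_add_one, mul_div_cancel_left₀ _ hab]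
  have hY : β ^ 2 / (a * b) = β + 1 := by rw [hβ, ← mul_add_one, mul_div_cancel_left₀ _ hab]
  rw [hX, hY]
  induction m with
  | zero => simp [biF, hne]
  | succ m ih =>
    obtain ⟨h0, h1⟩ := ih
    have h2 : biF a b (2 * (m + 1)) =
        a * ((α + 1) ^ (m + 1) - (β + 1) ^ (m + 1)) / (α - β) := by
      rw [show 2 * (m + 1) = 2 * m + 2 by ring, biF, if_pos (by simp [Nat.even_add]), h0, h1]
      field_simp
      ring
    refine ⟨h2, ?_⟩
    rw [show 2 * (m + 1) + 1 = 2 * m + 1 + 2 by ring, biF, if_neg (by simp [Nat.even_add]),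
      show 2 * m + 1 + 1 = 2 * (m + 1) by ring, h1, h2]
    field_simp
    linear_combination (-(α + 1) ^ m) * hα + (β + 1) ^ m * hβ

theorem biQ_binet (a b α β : ℝ) (hab : a * b ≠ 0) (hne : α - β ≠ 0)
    (hα : α ^ 2 = a * b * α + a * b) (hβ : β ^ 2 = a * b * β + a * b)
    (αs βs αss βss : ℍ[ℝ])
    (hαs : αs = ⟨a, α, a / (a * b) * α ^ 2, 1 / (a * b) * α ^ 3⟩)
    (hβs : βs = ⟨a, β, a / (a * b) * β ^ 2, 1 / (a * b) * β ^ 3⟩)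
    (hαss : αss = ⟨1, a / (a * b) * α, 1 / (a * b) * α ^ 2, a / (a * b) ^ 2 * α ^ 3⟩)
    (hβss : βss = ⟨1, a / (a * b) * β, 1 / (a * b) * β ^ 2, a / (a * b) ^ 2 * β ^ 3⟩) (m : ℕ) :
    biQ a b (2 * m) =
        (α - β)⁻¹ • ((α ^ 2 / (a * b)) ^ m • αs - (β ^ 2 / (a * b)) ^ m • βs) ∧
      biQ a b (2 * m + 1) =
        (α - β)⁻¹ • ((α * (α ^ 2 / (a * b)) ^ m) • αss - (β * (β ^ 2 / (a * b)) ^ m) • βss) := by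
  have h := biF_binet a b α β hab hne hα hβ
  have e0 : ∀ k, 2 * k + 2 = 2 * (k + 1) := fun k => by ring
  have e1 : ∀ k, 2 * k + 3 = 2 * (k + 1) + 1 := fun k => by ring
  have e2 : ∀ k, 2 * k + 4 = 2 * (k + 2) := fun k => by ring
  constructor <;> ext <;>
    simp only [Quaternion.re_smul, Quaternion.imI_smul, Quaternion.imJ_smul, Quaternion.imK_smul,
      Quaternion.re_sub, Quaternion.imI_sub, Quaternion.imJ_sub, Quaternion.imK_sub,
      smul_eq_mul] <;>
    simp only [biQ, e0, e1, e2, (h _).1, (h _).2,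
      hαs, hβs, hαss, hβss] <;>
    ring

theorem fst_inl_add_eps_mul_inl {R : Type*} [Semiring R] (x y : R) :
    (inl x + DualNumber.eps * inl y : DualNumber R).fst = x := by
  simp

theorem snd_inl_add_eps_mul_inl {R : Type*} [Semiring R] (x y : R) :
    (inl x + DualNumber.eps * inl y : DualNumber R).snd = y := by
  simp

/-- Catalan's identity for the bi-periodic dual Fibonacci quaternions, even index. -/
theorem biDQ_catalan_even (a b : ℝ) (hab : 0 < a * b) (α β : ℝ)
    (hα : α = (a * b + Real.sqrt ((a * b) ^ 2 + 4 * (a * b))) / 2)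
    (hβ : β = (a * b - Real.sqrt ((a * b) ^ 2 + 4 * (a * b))) / 2)
    (αs βs αss βss : ℍ[ℝ])
    (hαs : αs = ⟨a, α, a / (a * b) * α ^ 2, 1 / (a * b) * α ^ 3⟩)
    (hβs : βs = ⟨a, β, a / (a * b) * β ^ 2, 1 / (a * b) * β ^ 3⟩)
    (hαss : αss = ⟨1, a / (a * b) * α, 1 / (a * b) * α ^ 2, a / (a * b) ^ 2 * α ^ 3⟩)
    (hβss : βss = ⟨1, a / (a * b) * β, 1 / (a * b) * β ^ 2, a / (a * b) ^ 2 * β ^ 3⟩)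
    (r n : ℕ) (hr : Even r) (hn : Even n) (hrn : r ≤ n) :
    biDQ a b (n - r) * biDQ a b (n + r) - (biDQ a b n) ^ 2 =
      inl ((αs * βs * (((a * b) ^ r - β ^ (2 * r) : ℝ) : ℍ[ℝ])
            + βs * αs * (((a * b) ^ r - α ^ (2 * r) : ℝ) : ℍ[ℝ]))
          / (((a * b) ^ r * (α - β) ^ 2 : ℝ) : ℍ[ℝ]))
        + DualNumber.eps *
          inl (((αss * βs * ((α : ℝ) : ℍ[ℝ]) + αs * βss * ((β : ℝ) : ℍ[ℝ]))
                  * (((a * b) ^ r - β ^ (2 * r) : ℝ) : ℍ[ℝ])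
                + (βs * αss * ((α : ℝ) : ℍ[ℝ]) + βss * αs * ((β : ℝ) : ℍ[ℝ]))
                  * (((a * b) ^ r - α ^ (2 * r) : ℝ) : ℍ[ℝ]))
              / (((a * b) ^ r * (α - β) ^ 2 : ℝ) : ℍ[ℝ])) := by
  have hs : Real.sqrt ((a * b) ^ 2 + 4 * (a * b)) ^ 2 = (a * b) ^ 2 + 4 * (a * b) :=
    Real.sq_sqrt (by positivity)
  have hpos : 0 < Real.sqrt ((a * b) ^ 2 + 4 * (a * b)) := Real.sqrt_pos.2 (by positivity)
  have hc : a * b ≠ 0 := hab.ne'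
  have hne : α - β ≠ 0 := by
    rw [hα, hβ]
    ring_nf at hpos ⊢
    exact hpos.ne'
  have hα2 : α ^ 2 = a * b * α + a * b := by rw [hα]; linear_combination hs / 4
  have hβ2 : β ^ 2 = a * b * β + a * b := by rw [hβ]; linear_combination hs / 4
  have hmul : α * β = -(a * b) := by rw [hα, hβ]; linear_combination -hs / 4
  obtain ⟨s, rfl⟩ := hr.two_dvd
  obtain ⟨p, rfl⟩ : ∃ p, n = 2 * p + 2 * s := by
    obtain ⟨k, rfl⟩ := hn.two_dvd
    exact ⟨k - s, by omega⟩
  have hQ := biQ_binet a b α β hc hne hα2 hβ2 αs βs αss βss hαs hβs hαss hβss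
  have hXY : α ^ 2 / (a * b) * (β ^ 2 / (a * b)) = 1 := by
    rw [div_mul_div_comm, ← mul_pow, hmul, neg_sq, ← sq, div_self (pow_ne_zero 2 hc)]
  have hcr : (a * b) ^ (2 * s) ≠ 0 := pow_ne_zero _ hc
  have hXr : (a * b) ^ (2 * s) - α ^ (2 * (2 * s)) =
      (a * b) ^ (2 * s) * (1 - (α ^ 2 / (a * b)) ^ (2 * s)) := by
    rw [div_pow, ← pow_mul, mul_sub, mul_one, mul_div_cancel₀ _ hcr]
  have hYr : (a * b) ^ (2 * s) - β ^ (2 * (2 * s)) =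
      (a * b) ^ (2 * s) * (1 - (β ^ 2 / (a * b)) ^ (2 * s)) := by
    rw [div_pow, ← pow_mul, mul_sub, mul_one, mul_div_cancel₀ _ hcr]
  rw [hXr, hYr, show 2 * p + 2 * s - 2 * s = 2 * p by omega,
    show 2 * p + 2 * s + 2 * s = 2 * (p + 2 * s) by ring, ← mul_add]
  generalize (a * b) ^ (2 * s) = C at hcr ⊢
  generalize α ^ 2 / (a * b) = X at hXY hQ ⊢
  generalize β ^ 2 / (a * b) = Y at hXY hQ ⊢
  have hp : X ^ p * Y ^ p = 1 := by rw [← mul_pow, hXY, one_pow]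
  have hsp : X ^ s * Y ^ s = 1 := by rw [← mul_pow, hXY, one_pow]
  have hC : C⁻¹ * C = 1 := inv_mul_cancel₀ hcr
  generalize α - β = D at hQ ⊢
  ext1
  · simp only [biDQ, pow_two (inl _ + _), fst_sub, fst_mul, fst_inl_add_eps_mul_inl, (hQ _).1,
      div_eq_mul_inv, ← Quaternion.coe_inv, Quaternion.mul_coe_eq_smul, smul_sub, mul_sub,
      sub_mul, smul_mul_assoc, mul_smul_comm]
    match_scalars
    · ring
    · linear_combination
        (D⁻¹ ^ 2 * (X ^ s * Y ^ s - X ^ (2 * s))) * hp + D⁻¹ ^ 2 * hsp -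
          D⁻¹ ^ 2 * (1 - X ^ (2 * s)) * hC
    · linear_combination
        (D⁻¹ ^ 2 * (X ^ s * Y ^ s - Y ^ (2 * s))) * hp + D⁻¹ ^ 2 * hsp -
          D⁻¹ ^ 2 * (1 - Y ^ (2 * s)) * hC
    · ring
  · simp only [biDQ, pow_two (inl _ + _), snd_sub, snd_mul, fst_inl_add_eps_mul_inl,
      snd_inl_add_eps_mul_inl, smul_eq_mul, op_smul_eq_mul, (hQ _).1, (hQ _).2,
      div_eq_mul_inv, ← Quaternion.coe_inv, Quaternion.mul_coe_eq_smul, smul_sub, mul_sub,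
      sub_mul, smul_mul_assoc, mul_smul_comm]
    match_scalars
    · ring
    · linear_combination α * ((D⁻¹ ^ 2 * (X ^ s * Y ^ s - X ^ (2 * s))) * hp + D⁻¹ ^ 2 * hsp -
          D⁻¹ ^ 2 * (1 - X ^ (2 * s)) * hC)
    · linear_combination β * ((D⁻¹ ^ 2 * (X ^ s * Y ^ s - Y ^ (2 * s))) * hp + D⁻¹ ^ 2 * hsp -
          D⁻¹ ^ 2 * (1 - Y ^ (2 * s)) * hC)
    · ring
    · ring
    · linear_combination α * ((D⁻¹ ^ 2 * (X ^ s * Y ^ s - Y ^ (2 * s))) * hp + D⁻¹ ^ 2 * hsp -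
          D⁻¹ ^ 2 * (1 - Y ^ (2 * s)) * hC)
    · linear_combination β * ((D⁻¹ ^ 2 * (X ^ s * Y ^ s - X ^ (2 * s))) * hp + D⁻¹ ^ 2 * hsp -
          D⁻¹ ^ 2 * (1 - X ^ (2 * s)) * hC)
    · ring
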